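/- For every probability vector π = (π1, π2) with π1 ≥ π2 > 0 and 6·π1·π2 > 1 (equivalently Δ² < (1−θ)²/3 for the corresponding channel parameters), there exists D = D(π) > 0 such that for every integer d > D and every θ with d·θ² ≤ 1, taking Δ = (1−θ)(π2−π1) (so that the channel M has stationary distribution π), there is non-reconstruction for the broadcast process on the d-ary tree; in particular there is non-reconstruction at the Kesten–Stigum bound d·θ² = 1. -/

import Mathlib

open Finset Filter

namespace AsymIsing

/-- Level-`k` vertices of the rooted `d`-ary tree: paths of length `k` from the root. -/
abbrev Vert (d k : ℕ) : Type := Fin k → Fin d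

/-- A spin configuration on levels `0, …, n` of the `d`-ary tree. -/
abbrev Conf (d n : ℕ) : Type := ∀ k : Fin (n + 1), Vert d k → Fin 2

/-- A spin configuration on level `n` only. -/
abbrev LConf (d n : ℕ) : Type := Vert d n → Fin 2

/-- The transition matrix of the asymmetric binary channel; the paper's state `1`
corresponds to the index `0` and the state `2` to the index `1`. -/
noncomputable def Mmat (θ Δ : ℝ) : Fin 2 → Fin 2 → ℝ := fun i j =>
  if i = 0 then (if j = 0 then (1 + θ - Δ) / 2 else (1 - θ + Δ) / 2)
  else (if j = 0 then (1 - θ - Δ) / 2 else (1 + θ + Δ) / 2)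

/-- The stationary distribution `π = (π₁, π₂)` of the channel. -/
noncomputable def pst (θ Δ : ℝ) : Fin 2 → ℝ := fun i =>
  if i = 0 then 1 / 2 - Δ / (2 * (1 - θ)) else 1 / 2 + Δ / (2 * (1 - θ))

/-- The root spin of a configuration. -/
def root {d n : ℕ} (σ : Conf d n) : Fin 2 := σ ⟨0, n.succ_pos⟩ (fun i => i.elim0)

/-- The restriction of a configuration to the last (`n`-th) level. -/
def top {d n : ℕ} (σ : Conf d n) : LConf d n := σ (Fin.last n)

/-- The probability of a full configuration on levels `0, …, n` under the broadcast
process: the root is drawn from `π` and spins propagate along edges via `M`. -/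
noncomputable def confProb (d : ℕ) (θ Δ : ℝ) (n : ℕ) (σ : Conf d n) : ℝ :=
  pst θ Δ (root σ) *
    ∏ k : Fin n, ∏ v : Vert d (k + 1),
      Mmat θ Δ (σ k.castSucc (v ∘ Fin.castSucc)) (σ k.succ v)

/-- `P(σ(n) = A)`: the marginal law of the level-`n` spins. -/
noncomputable def levelProb (d : ℕ) (θ Δ : ℝ) (n : ℕ) (A : LConf d n) : ℝ :=
  ∑ σ : Conf d n, if top σ = A then confProb d θ Δ n σ else 0

/-- `P(σ_ρ = i, σ(n) = A)`. -/
noncomputable def jointProb (d : ℕ) (θ Δ : ℝ) (n : ℕ) (i : Fin 2) (A : LConf d n) : ℝ :=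
  ∑ σ : Conf d n, if root σ = i ∧ top σ = A then confProb d θ Δ n σ else 0

/-- The posterior `f_n(i, A) = P(σ_ρ = i ∣ σ(n) = A)`. -/
noncomputable def post (d : ℕ) (θ Δ : ℝ) (n : ℕ) (i : Fin 2) (A : LConf d n) : ℝ :=
  jointProb d θ Δ n i A / levelProb d θ Δ n A

/-- The law of `σ^i(n)`, i.e. `P(σ(n) = A ∣ σ_ρ = i)`. -/
noncomputable def condLevel (d : ℕ) (θ Δ : ℝ) (n : ℕ) (i : Fin 2) (A : LConf d n) : ℝ :=
  jointProb d θ Δ n i A / pst θ Δ i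

/-- The total variation distance between `σ^1(n)` and `σ^2(n)`. -/
noncomputable def tvDist (d : ℕ) (θ Δ : ℝ) (n : ℕ) : ℝ :=
  (1 / 2) * ∑ A : LConf d n, |condLevel d θ Δ n 0 A - condLevel d θ Δ n 1 A|

/-- The reconstruction problem is solvable if `limsup_n d_TV(σ^1(n), σ^2(n)) > 0`. -/
def solvable (d : ℕ) (θ Δ : ℝ) : Prop :=
  0 < Filter.limsup (fun n => tvDist d θ Δ n) Filter.atTop

/-- Non-reconstruction: `limsup_n d_TV(σ^1(n), σ^2(n)) = 0`. -/
def nonReconstruction (d : ℕ) (θ Δ : ℝ) : Prop :=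
  Filter.limsup (fun n => tvDist d θ Δ n) Filter.atTop = 0

/-- Expectation of a function of the level-`n` configuration, conditioned on `σ_ρ = 1`. -/
noncomputable def expect1 (d : ℕ) (θ Δ : ℝ) (n : ℕ) (g : LConf d n → ℝ) : ℝ :=
  ∑ A : LConf d n, condLevel d θ Δ n 0 A * g A

/-- `x_n = E f_n(1, σ^1(n)) − π₁`. -/
noncomputable def xseq (d : ℕ) (θ Δ : ℝ) (n : ℕ) : ℝ :=
  expect1 d θ Δ n (fun A => post d θ Δ n 0 A) - pst θ Δ 0

/-- `z_n = E (f_n(1, σ^1(n)) − π₁)²`. -/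
noncomputable def zseq (d : ℕ) (θ Δ : ℝ) (n : ℕ) : ℝ :=
  expect1 d θ Δ n (fun A => (post d θ Δ n 0 A - pst θ Δ 0) ^ 2)

/-- The restriction of a level-`(n+1)` configuration to the subtree of the `j`-th
child of the root (paths starting with `j`). -/
def restrictChild {d n : ℕ} (j : Fin d) (A : LConf d (n + 1)) : LConf d n :=
  fun w => A (Fin.cons j w)

/-- `Y_j = f_n(1, σ_j(n+1))`, as a function of the level-`(n+1)` configuration. -/
noncomputable def Yfun (d : ℕ) (θ Δ : ℝ) (n : ℕ) (j : Fin d) (A : LConf d (n + 1)) : ℝ :=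
  post d θ Δ n 0 (restrictChild j A)

/-- `Z₁ = ∏_j (1 + (θ/π₁)(Y_j − π₁))`, as a function of the level-`(n+1)` configuration. -/
noncomputable def Z1fun (d : ℕ) (θ Δ : ℝ) (n : ℕ) (A : LConf d (n + 1)) : ℝ :=
  ∏ j : Fin d, (1 + (θ / pst θ Δ 0) * (Yfun d θ Δ n j A - pst θ Δ 0))

/-- `Z₂ = ∏_j (1 − (θ/π₂)(Y_j − π₁))`, as a function of the level-`(n+1)` configuration. -/
noncomputable def Z2fun (d : ℕ) (θ Δ : ℝ) (n : ℕ) (A : LConf d (n + 1)) : ℝ :=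
  ∏ j : Fin d, (1 - (θ / pst θ Δ 1) * (Yfun d θ Δ n j A - pst θ Δ 0))

/-- The value of `Δ` making `π = (π₁, π₂)` the stationary distribution of the channel
with second eigenvalue `θ`, namely `Δ = (1 − θ)(π₂ − π₁)`. -/
noncomputable def Dlt (θ π1 π2 : ℝ) : ℝ := (1 - θ) * (π2 - π1)

/-- The Gaussian-approximation function
`f(s) = E[π₁ e^{sμ₁+√s W₁} / (π₁ e^{sμ₁+√s W₁} + π₂ e^{sμ₂+√s W₂})] − π₁`,
where `μ₁ = 1/(2π₁)`, `μ₂ = −(1+π₂)/(2π₂²)`, `W₁ ∼ N(0, 1/π₁)` (realized as `w/√π₁`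
for `w` standard Gaussian) and `W₂ = −(π₁/π₂)·W₁`. -/
noncomputable def gfun (π1 π2 : ℝ) (s : ℝ) : ℝ :=
  (∫ w : ℝ,
      (π1 * Real.exp (s * (1 / (2 * π1)) + Real.sqrt s * (w / Real.sqrt π1))) /
        (π1 * Real.exp (s * (1 / (2 * π1)) + Real.sqrt s * (w / Real.sqrt π1)) +
          π2 * Real.exp (s * (-(1 + π2) / (2 * π2 ^ 2)) +
            Real.sqrt s * (-(π1 / π2) * (w / Real.sqrt π1))))
    ∂(ProbabilityTheory.gaussianReal 0 1)) - π1

/-- One step of Bayesian updating of the posterior probability `p`: an independent observation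
`ω` has reference weight `Q ω` and likelihoods `1 + (1 - a) t ω`, `1 - a t ω` under the two
hypotheses. -/
noncomputable def stepOp {Ω : Type*} [Fintype Ω] (a : ℝ) (Q t : Ω → ℝ) :
    (ℝ → ℝ) →ₗ[ℝ] (ℝ → ℝ) where
  toFun f := fun p => ∑ ω, Q ω * ((1 + t ω * (p - a)) *
    f (p * (1 + t ω * (1 - a)) / (1 + t ω * (p - a))))
  map_add' f g := by
    funext p
    simp only [Pi.add_apply, mul_add, Finset.sum_add_distrib]
  map_smul' c f := by
    funext p
    simp only [Pi.smul_apply, smul_eq_mul, RingHom.id_apply, Finset.mul_sum]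
    exact Finset.sum_congr rfl fun ω _ => by ring

lemma stepOp_apply {Ω : Type*} [Fintype Ω] (a : ℝ) (Q t : Ω → ℝ) (f : ℝ → ℝ) (p : ℝ) :
    stepOp a Q t f p = ∑ ω, Q ω * ((1 + t ω * (p - a)) *
      f (p * (1 + t ω * (1 - a)) / (1 + t ω * (p - a)))) := rfl

lemma half_le_one_add_mul {t m : ℝ} (ht : |t| ≤ 1 / 2) (hm : |m| ≤ 1) : 1 / 2 ≤ 1 + t * m := by
  have h : |t * m| ≤ 1 / 2 := by
    rw [abs_mul]; nlinarith [abs_nonneg t, abs_nonneg m]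
  linarith [neg_abs_le (t * m)]

lemma abs_sub_le_one_of_mem {a p : ℝ} (ha0 : 0 < a) (ha1 : a < 1) (hp0 : 0 ≤ p) (hp1 : p ≤ 1) :
    |p - a| ≤ 1 := abs_le.2 ⟨by linarith, by linarith⟩

lemma updated_mem {a p t : ℝ} (ha0 : 0 < a) (ha1 : a < 1) (hp0 : 0 ≤ p) (hp1 : p ≤ 1)
    (ht : |t| ≤ 1 / 2) :
    0 ≤ p * (1 + t * (1 - a)) / (1 + t * (p - a)) ∧
      p * (1 + t * (1 - a)) / (1 + t * (p - a)) ≤ 1 := by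
  have h1 := half_le_one_add_mul ht (abs_sub_le_one_of_mem ha0 ha1 hp0 hp1)
  have h2 : 1 / 2 ≤ 1 + t * (1 - a) :=
    half_le_one_add_mul ht (abs_le.2 ⟨by linarith, by linarith⟩)
  have h3 : 1 / 2 ≤ 1 + t * (- a) :=
    half_le_one_add_mul ht (abs_le.2 ⟨by linarith, by linarith⟩)
  refine ⟨by positivity, ?_⟩
  rw [div_le_one (by linarith)]
  nlinarith [mul_nonneg (sub_nonneg.2 hp1) (by linarith : (0:ℝ) ≤ 1 + t * (-a))]

/-- The variance of the updated posterior, weighted by the evidence, bounded below. -/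
lemma updated_variance_lower {a p t η : ℝ} (ha0 : 0 < a) (ha1 : a < 1) (hp0 : 0 ≤ p) (hp1 : p ≤ 1)
    (ht : |t| ≤ η) (hη : η ≤ 1 / 2) :
    p * (1 - p) + (1 - 2 * a - (p - a)) * (p * (1 - p)) * t - (p * (1 - p)) ^ 2 * t ^ 2
        + (a * (1 - a)) ^ 2 * (p - a) * t ^ 3 - 2 * η * (p - a) ^ 2 * t ^ 2 ≤
      (1 + t * (p - a)) * (p * (1 + t * (1 - a)) / (1 + t * (p - a)) *
        (1 - p * (1 + t * (1 - a)) / (1 + t * (p - a)))) := by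
  have hm1 := abs_sub_le_one_of_mem ha0 ha1 hp0 hp1
  have h1 := half_le_one_add_mul (ht.trans hη) hm1
  have hne : 1 + t * (p - a) ≠ 0 := by linarith
  have hv0 : 0 ≤ p * (1 - p) := mul_nonneg hp0 (by linarith)
  have hv1 : p * (1 - p) ≤ 1 / 4 := by nlinarith [sq_nonneg (2 * p - 1)]
  have hab0 : 0 ≤ a * (1 - a) := mul_nonneg ha0.le (by linarith)
  have hab1 : a * (1 - a) ≤ 1 / 4 := by nlinarith [sq_nonneg (2 * a - 1)]
  have key : (1 + t * (p - a)) * (p * (1 + t * (1 - a)) / (1 + t * (p - a)) *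
        (1 - p * (1 + t * (1 - a)) / (1 + t * (p - a)))) =
      p * (1 - p) + (1 - 2 * a - (p - a)) * (p * (1 - p)) * t
        - (p * (1 - p)) ^ 2 * (t ^ 2 / (1 + t * (p - a))) := by
    field_simp
    ring
  have hdiv : t ^ 2 / (1 + t * (p - a)) =
      t ^ 2 - (p - a) * t ^ 3 + (p - a) ^ 2 * t ^ 4 / (1 + t * (p - a)) := by
    field_simp
    ring
  have hdiv2 : (p - a) ^ 2 * t ^ 4 / (1 + t * (p - a)) ≤ 2 * ((p - a) ^ 2 * t ^ 4) := by
    rw [div_le_iff₀ (by linarith)]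
    nlinarith [mul_nonneg (sq_nonneg (p - a)) (by positivity : (0:ℝ) ≤ t ^ 4)]
  rw [key, hdiv]
  have hη0 : 0 ≤ η := (abs_nonneg t).trans ht
  have ht4 : t ^ 4 ≤ η * t ^ 2 := by
    have : t ^ 4 = |t| ^ 2 * t ^ 2 := by rw [sq_abs]; ring
    rw [this]
    exact mul_le_mul_of_nonneg_right (by nlinarith [abs_nonneg t]) (sq_nonneg t)
  set v := p * (1 - p) with hv
  set m := p - a with hm
  have hv2 : v ^ 2 ≤ 1 / 16 := by nlinarith
  have hA : v ^ 2 * ((m) ^ 2 * t ^ 4 / (1 + t * m)) ≤ η * m ^ 2 * t ^ 2 := by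
    calc _ ≤ 1 / 16 * (2 * (m ^ 2 * t ^ 4)) :=
          mul_le_mul hv2 hdiv2 (by positivity) (by norm_num)
      _ ≤ 1 * (m ^ 2 * (η * t ^ 2)) := by
          have := mul_le_mul_of_nonneg_left ht4 (sq_nonneg m)
          have h0 : 0 ≤ m ^ 2 * t ^ 4 := by positivity
          linarith
      _ = _ := by ring
  have hdiff : v ^ 2 - (a * (1 - a)) ^ 2 = m * ((1 - 2 * a - m) * (v + a * (1 - a))) := by
    rw [hv, hm]; ring
  have hbd : |(1 - 2 * a - m) * (v + a * (1 - a))| ≤ 1 := by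
    rw [abs_mul]
    have h2 : |1 - 2 * a - m| ≤ 2 := abs_le.2 ⟨by rw [hm]; linarith, by rw [hm]; linarith⟩
    have h3 : |v + a * (1 - a)| ≤ 1 / 2 := abs_le.2 ⟨by linarith, by linarith⟩
    nlinarith [abs_nonneg (1 - 2 * a - m), abs_nonneg (v + a * (1 - a))]
  have hB : -(η * m ^ 2 * t ^ 2) ≤ (v ^ 2 - (a * (1 - a)) ^ 2) * (m * t ^ 3) := by
    rw [hdiff]
    set c := (1 - 2 * a - m) * (v + a * (1 - a))
    have h4 : |t * c| ≤ η := by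
      rw [abs_mul]; nlinarith [abs_nonneg t, abs_nonneg c]
    have h5 := neg_abs_le (t * c)
    have h6 : 0 ≤ m ^ 2 * t ^ 2 := by positivity
    have h7 := mul_le_mul_of_nonneg_right (by linarith : -η ≤ t * c) h6
    calc -(η * m ^ 2 * t ^ 2) = -η * (m ^ 2 * t ^ 2) := by ring
      _ ≤ t * c * (m ^ 2 * t ^ 2) := h7
      _ = m * c * (m * t ^ 3) := by ring
  generalize m ^ 2 * t ^ 4 / (1 + t * m) = X at hA
  linarith

/-- The crude lower bound for the variance of the updated posterior. -/
lemma updated_variance_lower_crude {a p t : ℝ} (ha0 : 0 < a) (ha1 : a < 1) (hp0 : 0 ≤ p)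
    (hp1 : p ≤ 1) (ht : |t| ≤ 1 / 2) :
    p * (1 - p) + (1 - 2 * a - (p - a)) * (p * (1 - p)) * t - 1 / 8 * t ^ 2 ≤
      (1 + t * (p - a)) * (p * (1 + t * (1 - a)) / (1 + t * (p - a)) *
        (1 - p * (1 + t * (1 - a)) / (1 + t * (p - a)))) := by
  have hm1 := abs_sub_le_one_of_mem ha0 ha1 hp0 hp1
  have h1 := half_le_one_add_mul ht hm1
  have hne : 1 + t * (p - a) ≠ 0 := by linarith
  have hv0 : 0 ≤ p * (1 - p) := mul_nonneg hp0 (by linarith)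
  have hv1 : p * (1 - p) ≤ 1 / 4 := by nlinarith [sq_nonneg (2 * p - 1)]
  have key : (1 + t * (p - a)) * (p * (1 + t * (1 - a)) / (1 + t * (p - a)) *
        (1 - p * (1 + t * (1 - a)) / (1 + t * (p - a)))) =
      p * (1 - p) + (1 - 2 * a - (p - a)) * (p * (1 - p)) * t
        - (p * (1 - p)) ^ 2 * (t ^ 2 / (1 + t * (p - a))) := by
    field_simp
    ring
  have hdiv2 : t ^ 2 / (1 + t * (p - a)) ≤ 2 * t ^ 2 := by
    rw [div_le_iff₀ (by linarith)]
    nlinarith [sq_nonneg t]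
  have hv2 : (p * (1 - p)) ^ 2 ≤ 1 / 16 := by nlinarith
  have := mul_le_mul hv2 hdiv2 (by positivity) (by norm_num : (0:ℝ) ≤ 1 / 16)
  rw [key]
  linarith

/-- The squared variance of the updated posterior, weighted by the evidence, bounded above. -/
lemma updated_variance_sq_upper {a p t η : ℝ} (ha0 : 0 < a) (ha1 : a < 1) (hp0 : 0 ≤ p)
    (hp1 : p ≤ 1) (ht : |t| ≤ η) (hη : η ≤ 1 / 2) :
    (1 + t * (p - a)) * (p * (1 + t * (1 - a)) / (1 + t * (p - a)) *
        (1 - p * (1 + t * (1 - a)) / (1 + t * (p - a)))) ^ 2 ≤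
      (p * (1 - p)) ^ 2 + (2 * (1 - 2 * a) - 3 * (p - a)) * (p * (1 - p)) ^ 2 * t
        + (p * (1 - p)) ^ 2 * (1 - 6 * (p * (1 - p))) * t ^ 2 + 100 * η * t ^ 2 := by
  have hm1 := abs_sub_le_one_of_mem ha0 ha1 hp0 hp1
  have h1 := half_le_one_add_mul (ht.trans hη) hm1
  have hne : 1 + t * (p - a) ≠ 0 := by linarith
  have hv0 : 0 ≤ p * (1 - p) := mul_nonneg hp0 (by linarith)
  have hv1 : p * (1 - p) ≤ 1 / 4 := by nlinarith [sq_nonneg (2 * p - 1)]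
  have hab0 : 0 ≤ a * (1 - a) := mul_nonneg ha0.le (by linarith)
  have hab1 : a * (1 - a) ≤ 1 / 4 := by nlinarith [sq_nonneg (2 * a - 1)]
  have hη0 : 0 ≤ η := (abs_nonneg t).trans ht
  have hp : p * (1 - p) = a * (1 - a) + (1 - 2 * a) * (p - a) - (p - a) ^ 2 := by ring
  have key : (1 + t * (p - a)) * (p * (1 + t * (1 - a)) / (1 + t * (p - a)) *
        (1 - p * (1 + t * (1 - a)) / (1 + t * (p - a)))) ^ 2 =
      (p * (1 - p)) ^ 2 * (((1 + t * (1 - a)) * (1 - t * a)) ^ 2 / (1 + t * (p - a)) ^ 3) := by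
    field_simp
    ring
  rw [key]
  have hκ : |1 - 2 * a| ≤ 1 := abs_le.2 ⟨by linarith, by linarith⟩
  set α := 2 * (1 - 2 * a) - 3 * (p - a) with hα
  have hα5 : |α| ≤ 5 := by
    rw [abs_le] at hκ hm1 ⊢
    constructor <;> linarith
  set β := 1 - 6 * (p * (1 - p)) with hβ
  have hβ1 : |β| ≤ 1 := abs_le.2 ⟨by linarith, by linarith⟩
  set v := p * (1 - p) with hv
  set m := p - a with hm
  set g := a * (1 - a) with hg
  set κ := 1 - 2 * a with hκd
  have hκg : κ ^ 2 = 1 - 4 * g := by rw [hκd, hg]; ring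
  have hP : (1 + t * (1 - a)) * (1 - t * a) = 1 + κ * t - g * t ^ 2 := by
    rw [hκd, hg]; ring
  set r := m ^ 3 + 3 * m ^ 2 * α + 3 * m * β + 2 * κ * g + (m ^ 3 * α + 3 * m ^ 2 * β - g ^ 2) * t
    + m ^ 3 * β * t ^ 2 with hr
  have hid : (1 + κ * t - g * t ^ 2) ^ 2 =
      (1 + t * m) ^ 3 * (1 + α * t + β * t ^ 2) - t ^ 3 * r := by
    have hβ' : β = 1 - 6 * (g + κ * m - m ^ 2) := by rw [hβ, hp]
    have : (1 + κ * t - g * t ^ 2) ^ 2 = (1 + t * m) ^ 3 * (1 + α * t + β * t ^ 2) - t ^ 3 * r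
        + t ^ 2 * (κ ^ 2 - (1 - 4 * g)) := by
      rw [hr, hβ', hα]; ring
    rw [this, hκg]; ring
  have hm2 : |m ^ 2| ≤ 1 := by rw [abs_pow]; exact pow_le_one₀ (abs_nonneg _) hm1
  have hm3 : |m ^ 3| ≤ 1 := by rw [abs_pow]; exact pow_le_one₀ (abs_nonneg _) hm1
  have ht1 : |t| ≤ 1 := by linarith
  have hprod : ∀ {x y c : ℝ}, |x| ≤ 1 → |y| ≤ c → |x * y| ≤ c := by
    intro x y c hx hy
    rw [abs_mul]
    calc |x| * |y| ≤ 1 * c := mul_le_mul hx hy (abs_nonneg _) (by norm_num)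
      _ = c := one_mul c
  have hg1 : |g| ≤ 1 := abs_le.2 ⟨by linarith, by linarith⟩
  have e1 := abs_le.1 hm3
  have e2 := abs_le.1 (hprod hm2 hα5)
  have e3 := abs_le.1 (hprod hm1 hβ1)
  have e4 := abs_le.1 (hprod hκ hg1)
  have e5 := abs_le.1 (hprod ht1 (hprod hm3 hα5))
  have e6 := abs_le.1 (hprod ht1 (hprod hm2 hβ1))
  have e7 := abs_le.1 (hprod ht1 (hprod hg1 hg1))
  have e8 := abs_le.1 (hprod ht1 (hprod ht1 (hprod hm3 hβ1)))
  have hrb : |r| ≤ 40 := by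
    rw [abs_le, hr]
    constructor <;> linarith
  have ht3 : |t ^ 3| ≤ η * t ^ 2 := by
    have : |t ^ 3| = |t| * t ^ 2 := by rw [abs_pow, ← sq_abs t]; ring
    rw [this]
    exact mul_le_mul_of_nonneg_right ht (sq_nonneg t)
  have hD3 : 1 / 8 ≤ (1 + t * m) ^ 3 := by
    calc (1 / 8 : ℝ) = (1 / 2) ^ 3 := by norm_num
      _ ≤ _ := pow_le_pow_left₀ (by norm_num) h1 3
  have htr : |t ^ 3 * r| ≤ 40 * (η * t ^ 2) := by
    rw [abs_mul]
    calc |t ^ 3| * |r| ≤ η * t ^ 2 * 40 := mul_le_mul ht3 hrb (abs_nonneg _) (by positivity)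
      _ = _ := by ring
  have hX0 : 0 ≤ η * t ^ 2 := by positivity
  have hquot : ((1 + t * (1 - a)) * (1 - t * a)) ^ 2 / (1 + t * m) ^ 3 ≤
      1 + α * t + β * t ^ 2 + 320 * (η * t ^ 2) := by
    rw [hP, hid, div_le_iff₀ (by linarith)]
    have := neg_abs_le (t ^ 3 * r)
    have h9 := mul_le_mul_of_nonneg_right hD3 hX0
    linarith
  have hv2 : v ^ 2 ≤ 1 / 16 := by
    calc v ^ 2 ≤ (1 / 4) ^ 2 := pow_le_pow_left₀ hv0 hv1 2
      _ = 1 / 16 := by norm_num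
  have hfin := mul_le_mul_of_nonneg_left hquot (sq_nonneg v)
  have hfin2 := mul_le_mul_of_nonneg_right hv2 hX0
  linarith

section StepOp

variable {Ω : Type*} [Fintype Ω] {a η : ℝ} {Q t : Ω → ℝ}

lemma stepOp_mono (ha0 : 0 < a) (ha1 : a < 1) (hQ : ∀ ω, 0 ≤ Q ω) (ht : ∀ ω, |t ω| ≤ 1 / 2)
    {f g : ℝ → ℝ} (hfg : ∀ p, 0 ≤ p → p ≤ 1 → f p ≤ g p) {p : ℝ} (hp0 : 0 ≤ p) (hp1 : p ≤ 1) :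
    stepOp a Q t f p ≤ stepOp a Q t g p := by
  rw [stepOp_apply, stepOp_apply]
  refine Finset.sum_le_sum fun ω _ => mul_le_mul_of_nonneg_left ?_ (hQ ω)
  have h1 := half_le_one_add_mul (ht ω) (abs_sub_le_one_of_mem ha0 ha1 hp0 hp1)
  obtain ⟨h2, h3⟩ := updated_mem ha0 ha1 hp0 hp1 (ht ω)
  exact mul_le_mul_of_nonneg_left (hfg _ h2 h3) (by linarith)

lemma stepOp_pow_mono (ha0 : 0 < a) (ha1 : a < 1) (hQ : ∀ ω, 0 ≤ Q ω)
    (ht : ∀ ω, |t ω| ≤ 1 / 2) (k : ℕ) {f g : ℝ → ℝ}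
    (hfg : ∀ p, 0 ≤ p → p ≤ 1 → f p ≤ g p) :
    ∀ p, 0 ≤ p → p ≤ 1 → (stepOp a Q t ^ k) f p ≤ (stepOp a Q t ^ k) g p := by
  induction k with
  | zero => simpa using hfg
  | succ k ih =>
    intro p hp0 hp1
    rw [pow_succ', Module.End.mul_apply, Module.End.mul_apply]
    exact stepOp_mono ha0 ha1 hQ ht ih hp0 hp1

lemma stepOp_const (hQ1 : ∑ ω, Q ω = 1) (hQt : ∑ ω, Q ω * t ω = 0) (c p : ℝ) :
    stepOp a Q t (fun _ => c) p = c := by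
  rw [stepOp_apply]
  calc _ = ∑ ω, (Q ω * c + Q ω * t ω * ((p - a) * c)) :=
        Finset.sum_congr rfl fun ω _ => by ring
    _ = c := by rw [Finset.sum_add_distrib, ← Finset.sum_mul, ← Finset.sum_mul, hQ1, hQt]; ring

lemma stepOp_sub_const (ha0 : 0 < a) (ha1 : a < 1) (hQ1 : ∑ ω, Q ω = 1)
    (hQt : ∑ ω, Q ω * t ω = 0) (ht : ∀ ω, |t ω| ≤ 1 / 2) {p : ℝ} (hp0 : 0 ≤ p) (hp1 : p ≤ 1) :
    stepOp a Q t (fun p => p - a) p = p - a := by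
  rw [stepOp_apply]
  calc _ = ∑ ω, (Q ω * (p - a) + Q ω * t ω * (p * (1 - a) - a * (p - a))) := by
        refine Finset.sum_congr rfl fun ω _ => ?_
        have h1 := half_le_one_add_mul (ht ω) (abs_sub_le_one_of_mem ha0 ha1 hp0 hp1)
        have hne : 1 + t ω * (p - a) ≠ 0 := by linarith
        field_simp
        ring
    _ = p - a := by rw [Finset.sum_add_distrib, ← Finset.sum_mul, ← Finset.sum_mul, hQ1, hQt]; ring

/-- Expectation of a cubic polynomial in `t` under the weights `Q`, when `t` is centred. -/
lemma sum_weight_cubic (hQ1 : ∑ ω, Q ω = 1) (hQt : ∑ ω, Q ω * t ω = 0) (A0 A1 A2 A3 : ℝ) :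
    ∑ ω, Q ω * (A0 + A1 * t ω + A2 * t ω ^ 2 + A3 * t ω ^ 3) =
      A0 + A2 * (∑ ω, Q ω * t ω ^ 2) + A3 * (∑ ω, Q ω * t ω ^ 3) := by
  calc _ = ∑ ω, (Q ω * A0 + Q ω * t ω * A1 + A2 * (Q ω * t ω ^ 2) + A3 * (Q ω * t ω ^ 3)) :=
        Finset.sum_congr rfl fun ω _ => by ring
    _ = _ := by
        simp only [Finset.sum_add_distrib, ← Finset.sum_mul, ← Finset.mul_sum, hQ1, hQt]
        ring

lemma stepOp_variance_lower (ha0 : 0 < a) (ha1 : a < 1) (hQ : ∀ ω, 0 ≤ Q ω)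
    (hQ1 : ∑ ω, Q ω = 1) (hQt : ∑ ω, Q ω * t ω = 0) (ht : ∀ ω, |t ω| ≤ η) (hη : η ≤ 1 / 2)
    {p : ℝ} (hp0 : 0 ≤ p) (hp1 : p ≤ 1) :
    p * (1 - p) - (∑ ω, Q ω * t ω ^ 2) * (p * (1 - p)) ^ 2
        + (a * (1 - a)) ^ 2 * (∑ ω, Q ω * t ω ^ 3) * (p - a)
        - 2 * η * (∑ ω, Q ω * t ω ^ 2) * (p - a) ^ 2 ≤
      stepOp a Q t (fun p => p * (1 - p)) p := by
  rw [stepOp_apply]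
  have h := sum_weight_cubic hQ1 hQt (p * (1 - p)) ((1 - 2 * a - (p - a)) * (p * (1 - p)))
    (-(p * (1 - p)) ^ 2 - 2 * η * (p - a) ^ 2) ((a * (1 - a)) ^ 2 * (p - a))
  refine le_trans (le_of_eq ?_) (h.symm.le.trans (Finset.sum_le_sum fun ω _ =>
    mul_le_mul_of_nonneg_left (le_trans (le_of_eq ?_)
      (updated_variance_lower ha0 ha1 hp0 hp1 (ht ω) hη)) (hQ ω)))
  · ring
  · ring

lemma stepOp_variance_lower_crude (ha0 : 0 < a) (ha1 : a < 1) (hQ : ∀ ω, 0 ≤ Q ω)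
    (hQ1 : ∑ ω, Q ω = 1) (hQt : ∑ ω, Q ω * t ω = 0) (ht : ∀ ω, |t ω| ≤ 1 / 2)
    {p : ℝ} (hp0 : 0 ≤ p) (hp1 : p ≤ 1) :
    p * (1 - p) - 1 / 8 * (∑ ω, Q ω * t ω ^ 2) ≤ stepOp a Q t (fun p => p * (1 - p)) p := by
  rw [stepOp_apply]
  have h := sum_weight_cubic hQ1 hQt (p * (1 - p)) ((1 - 2 * a - (p - a)) * (p * (1 - p)))
    (-(1 / 8)) 0
  refine le_trans (le_of_eq ?_) (h.symm.le.trans (Finset.sum_le_sum fun ω _ =>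
    mul_le_mul_of_nonneg_left (le_trans (le_of_eq ?_)
      (updated_variance_lower_crude ha0 ha1 hp0 hp1 (ht ω))) (hQ ω)))
  · ring
  · ring

lemma stepOp_variance_sq_upper (ha0 : 0 < a) (ha1 : a < 1) (hQ : ∀ ω, 0 ≤ Q ω)
    (hQ1 : ∑ ω, Q ω = 1) (hQt : ∑ ω, Q ω * t ω = 0) (ht : ∀ ω, |t ω| ≤ η) (hη : η ≤ 1 / 2)
    {p : ℝ} (hp0 : 0 ≤ p) (hp1 : p ≤ 1) :
    stepOp a Q t (fun p => (p * (1 - p)) ^ 2) p ≤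
      (p * (1 - p)) ^ 2 + (∑ ω, Q ω * t ω ^ 2) * ((p * (1 - p)) ^ 2 - 6 * (p * (1 - p)) ^ 3)
        + 100 * η * (∑ ω, Q ω * t ω ^ 2) := by
  rw [stepOp_apply]
  have h := sum_weight_cubic hQ1 hQt ((p * (1 - p)) ^ 2)
    ((2 * (1 - 2 * a) - 3 * (p - a)) * (p * (1 - p)) ^ 2)
    ((p * (1 - p)) ^ 2 * (1 - 6 * (p * (1 - p))) + 100 * η) 0
  refine le_trans (Finset.sum_le_sum fun ω _ => mul_le_mul_of_nonneg_left
    ((updated_variance_sq_upper ha0 ha1 hp0 hp1 (ht ω) hη).trans (le_of_eq ?_)) (hQ ω))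
    (h.le.trans (le_of_eq ?_))
  · ring
  · ring

/-- The expectation of `f` of the posterior after `k` observations, starting from the prior `a`. -/
noncomputable def postExp (a : ℝ) (Q t : Ω → ℝ) (k : ℕ) (f : ℝ → ℝ) : ℝ := (stepOp a Q t ^ k) f a

lemma postExp_zero (f : ℝ → ℝ) : postExp a Q t 0 f = f a := rfl

lemma postExp_succ (k : ℕ) (f : ℝ → ℝ) :
    postExp a Q t (k + 1) f = postExp a Q t k (stepOp a Q t f) := by
  rw [postExp, postExp, pow_succ, Module.End.mul_apply]

lemma postExp_mono (ha0 : 0 < a) (ha1 : a < 1) (hQ : ∀ ω, 0 ≤ Q ω)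
    (ht : ∀ ω, |t ω| ≤ 1 / 2) (k : ℕ) {f g : ℝ → ℝ}
    (hfg : ∀ p, 0 ≤ p → p ≤ 1 → f p ≤ g p) : postExp a Q t k f ≤ postExp a Q t k g :=
  stepOp_pow_mono ha0 ha1 hQ ht k hfg a ha0.le ha1.le

lemma postExp_congr (ha0 : 0 < a) (ha1 : a < 1) (hQ : ∀ ω, 0 ≤ Q ω)
    (ht : ∀ ω, |t ω| ≤ 1 / 2) (k : ℕ) {f g : ℝ → ℝ}
    (hfg : ∀ p, 0 ≤ p → p ≤ 1 → f p = g p) : postExp a Q t k f = postExp a Q t k g :=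
  le_antisymm (postExp_mono ha0 ha1 hQ ht k fun p h0 h1 => (hfg p h0 h1).le)
    (postExp_mono ha0 ha1 hQ ht k fun p h0 h1 => (hfg p h0 h1).ge)

lemma postExp_add (k : ℕ) (f g : ℝ → ℝ) :
    postExp a Q t k (fun p => f p + g p) = postExp a Q t k f + postExp a Q t k g := by
  have : (fun p => f p + g p) = f + g := rfl
  rw [postExp, this, map_add]; rfl

lemma postExp_mul (k : ℕ) (c : ℝ) (f : ℝ → ℝ) :
    postExp a Q t k (fun p => c * f p) = c * postExp a Q t k f := by
  have : (fun p => c * f p) = c • f := rfl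
  rw [postExp, this, map_smul]; rfl

lemma postExp_const (ha0 : 0 < a) (ha1 : a < 1) (hQ : ∀ ω, 0 ≤ Q ω) (hQ1 : ∑ ω, Q ω = 1)
    (hQt : ∑ ω, Q ω * t ω = 0) (ht : ∀ ω, |t ω| ≤ 1 / 2) (k : ℕ) (c : ℝ) :
    postExp a Q t k (fun _ => c) = c := by
  induction k with
  | zero => rfl
  | succ k ih =>
    rw [postExp_succ, postExp_congr ha0 ha1 hQ ht k fun p _ _ => stepOp_const hQ1 hQt c p, ih]

lemma postExp_sub_const (ha0 : 0 < a) (ha1 : a < 1) (hQ : ∀ ω, 0 ≤ Q ω) (hQ1 : ∑ ω, Q ω = 1)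
    (hQt : ∑ ω, Q ω * t ω = 0) (ht : ∀ ω, |t ω| ≤ 1 / 2) (k : ℕ) :
    postExp a Q t k (fun p => p - a) = 0 := by
  induction k with
  | zero => simp [postExp_zero]
  | succ k ih =>
    rw [postExp_succ, postExp_congr ha0 ha1 hQ ht k fun p h0 h1 =>
      stepOp_sub_const ha0 ha1 hQ1 hQt ht h0 h1, ih]

/-- The expected squared deviation of the posterior and its expected variance add up to the
prior variance. -/
lemma postExp_sq_dev (ha0 : 0 < a) (ha1 : a < 1) (hQ : ∀ ω, 0 ≤ Q ω) (hQ1 : ∑ ω, Q ω = 1)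
    (hQt : ∑ ω, Q ω * t ω = 0) (ht : ∀ ω, |t ω| ≤ 1 / 2) (k : ℕ) :
    postExp a Q t k (fun p => (p - a) ^ 2) =
      a * (1 - a) - postExp a Q t k (fun p => p * (1 - p)) := by
  have h : (fun p : ℝ => (p - a) ^ 2) = fun p => (a * (1 - a) + (1 - 2 * a) * (p - a)) +
      (-1) * (p * (1 - p)) := by funext p; ring
  rw [h, postExp_add, postExp_add, postExp_const ha0 ha1 hQ hQ1 hQt ht, postExp_mul, postExp_mul,
    postExp_sub_const ha0 ha1 hQ hQ1 hQt ht]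
  ring

lemma postExp_variance_succ_lower (ha0 : 0 < a) (ha1 : a < 1) (hQ : ∀ ω, 0 ≤ Q ω)
    (hQ1 : ∑ ω, Q ω = 1) (hQt : ∑ ω, Q ω * t ω = 0) (ht : ∀ ω, |t ω| ≤ η) (hη : η ≤ 1 / 2)
    (k : ℕ) :
    postExp a Q t k (fun p => p * (1 - p))
        - (∑ ω, Q ω * t ω ^ 2) * postExp a Q t k (fun p => (p * (1 - p)) ^ 2)
        - 2 * η * (∑ ω, Q ω * t ω ^ 2) *
          (a * (1 - a) - postExp a Q t k (fun p => p * (1 - p))) ≤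
      postExp a Q t (k + 1) (fun p => p * (1 - p)) := by
  have ht' : ∀ ω, |t ω| ≤ 1 / 2 := fun ω => (ht ω).trans hη
  rw [postExp_succ, ← postExp_sq_dev ha0 ha1 hQ hQ1 hQt ht']
  refine le_trans (le_of_eq ?_) (postExp_mono ha0 ha1 hQ ht' k fun p h0 h1 =>
    stepOp_variance_lower ha0 ha1 hQ hQ1 hQt ht hη h0 h1)
  simp only [sub_eq_add_neg, ← neg_mul]
  rw [postExp_add, postExp_add, postExp_add, postExp_mul, postExp_mul, postExp_mul]
  have := postExp_sub_const ha0 ha1 hQ hQ1 hQt ht' k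
  simp only [sub_eq_add_neg] at this
  rw [this]
  ring

lemma postExp_variance_succ_lower_crude (ha0 : 0 < a) (ha1 : a < 1) (hQ : ∀ ω, 0 ≤ Q ω)
    (hQ1 : ∑ ω, Q ω = 1) (hQt : ∑ ω, Q ω * t ω = 0) (ht : ∀ ω, |t ω| ≤ 1 / 2) (k : ℕ) :
    postExp a Q t k (fun p => p * (1 - p)) - 1 / 8 * (∑ ω, Q ω * t ω ^ 2) ≤
      postExp a Q t (k + 1) (fun p => p * (1 - p)) := by
  rw [postExp_succ]
  refine le_trans (le_of_eq ?_) (postExp_mono ha0 ha1 hQ ht k fun p h0 h1 =>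
    stepOp_variance_lower_crude ha0 ha1 hQ hQ1 hQt ht h0 h1)
  simp only [sub_eq_add_neg]
  rw [postExp_add, postExp_const ha0 ha1 hQ hQ1 hQt ht]

lemma postExp_variance_sq_succ_upper (ha0 : 0 < a) (ha1 : a < 1) (hQ : ∀ ω, 0 ≤ Q ω)
    (hQ1 : ∑ ω, Q ω = 1) (hQt : ∑ ω, Q ω * t ω = 0) (ht : ∀ ω, |t ω| ≤ η) (hη : η ≤ 1 / 2)
    (k : ℕ) :
    postExp a Q t (k + 1) (fun p => (p * (1 - p)) ^ 2) ≤
      postExp a Q t k (fun p => (p * (1 - p)) ^ 2)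
        + (∑ ω, Q ω * t ω ^ 2) * (postExp a Q t k (fun p => (p * (1 - p)) ^ 2)
          - 6 * postExp a Q t k (fun p => (p * (1 - p)) ^ 3))
        + 100 * η * (∑ ω, Q ω * t ω ^ 2) := by
  have ht' : ∀ ω, |t ω| ≤ 1 / 2 := fun ω => (ht ω).trans hη
  rw [postExp_succ]
  refine le_trans (postExp_mono ha0 ha1 hQ ht' k fun p h0 h1 =>
    stepOp_variance_sq_upper ha0 ha1 hQ hQ1 hQt ht hη h0 h1) (le_of_eq ?_)
  rw [postExp_add, postExp_add, postExp_const ha0 ha1 hQ hQ1 hQt ht', postExp_mul]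
  simp only [sub_eq_add_neg, ← neg_mul]
  rw [postExp_add, postExp_mul]

/-- The expectation of the tangent-line bound `2 g v² - g² v ≤ v³`, i.e. of `0 ≤ v (v - g)²`. -/
lemma postExp_variance_cube_lower (ha0 : 0 < a) (ha1 : a < 1) (hQ : ∀ ω, 0 ≤ Q ω)
    (ht : ∀ ω, |t ω| ≤ 1 / 2) (k : ℕ) (g : ℝ) :
    2 * g * postExp a Q t k (fun p => (p * (1 - p)) ^ 2)
        - g ^ 2 * postExp a Q t k (fun p => p * (1 - p)) ≤
      postExp a Q t k (fun p => (p * (1 - p)) ^ 3) := by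
  refine le_trans (le_of_eq ?_) (postExp_mono ha0 ha1 hQ ht k
    (f := fun p => 2 * g * (p * (1 - p)) ^ 2 + (-g ^ 2) * (p * (1 - p))) fun p h0 h1 => ?_)
  · rw [postExp_add, postExp_mul, postExp_mul]; ring
  · nlinarith [mul_nonneg (mul_nonneg h0 (sub_nonneg.2 h1)) (sq_nonneg (p * (1 - p) - g))]

end StepOp

/-- Discrete comparison argument for the normalised first and second moments `y₁`, `y₂` of the
posterior variance. -/
lemma moment_comparison {B δ η : ℝ} {y1 y2 : ℕ → ℝ} {N : ℕ} (hB4 : 4 ≤ B) (hB6 : B ≤ 6)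
    (hδ0 : 0 ≤ δ) (hδ : δ ≤ 1 / 6) (hη0 : 0 ≤ η) (hη : 44000 * η ≤ 6 - B)
    (hN : (N : ℝ) * δ ≤ 1) (h10 : y1 0 = 1) (h20 : y2 0 = 1)
    (h1 : ∀ k, y1 k - δ * y2 k - 2 * η * B * δ * (1 - y1 k) ≤ y1 (k + 1))
    (h1' : ∀ k, y1 k - 5 * δ ≤ y1 (k + 1))
    (h2 : ∀ k, y2 (k + 1) ≤ y2 k + δ * (B * y2 k - 12 * y2 k + 6 * y1 k) + 21600 * η * δ) :
    1 - N * δ + (6 - B) / 112 * (N * ((N : ℝ) - 1) * δ ^ 2) ≤ y1 N := by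
  have hy1 : ∀ k : ℕ, 1 - y1 k ≤ 5 * (k * δ) := by
    intro k
    induction k with
    | zero => simp [h10]
    | succ k ih => push_cast; linarith [h1' k]
  set c := (6 - B) / 14 with hc
  have hc0 : 0 ≤ c := by rw [hc]; linarith
  have main : ∀ k : ℕ, (k : ℝ) * δ ≤ 1 →
      c / 8 * (k * ((k : ℝ) - 1) * δ ^ 2) ≤ y1 k - 1 + k * δ ∧
      c * (k * δ) ≤ 1 - y2 k + 2 * (y1 k - 1 + k * δ) := by
    intro k
    induction k with
    | zero => intro _; simp [h10, h20]
    | succ k ih =>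
      intro hk
      push_cast at hk ⊢
      have hk0 : (0:ℝ) ≤ k := k.cast_nonneg
      have hkδ : (k : ℝ) * δ ≤ 1 := by nlinarith
      obtain ⟨hD, hG⟩ := ih hkδ
      set s := (k : ℝ) * δ with hs
      have hs0 : 0 ≤ s := mul_nonneg hk0 hδ0
      have hkk : 0 ≤ (k : ℝ) * ((k : ℝ) - 1) * δ ^ 2 := by
        rcases Nat.eq_zero_or_pos k with rfl | hpos
        · simp
        · have : (1 : ℝ) ≤ k := by exact_mod_cast hpos
          have : (0:ℝ) ≤ k - 1 := by linarith
          positivity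
      set D := y1 k - 1 + s with hDdef
      set G := 1 - y2 k + 2 * D with hGdef
      have hD0 : 0 ≤ D := le_trans (by positivity) hD
      have herr : 2 * η * B * δ * (1 - y1 k) ≤ 60 * η * δ * s := by
        have hx : 0 ≤ η * δ := mul_nonneg hη0 hδ0
        calc 2 * η * B * δ * (1 - y1 k) ≤ 2 * η * B * δ * (5 * s) :=
              mul_le_mul_of_nonneg_left (hy1 k) (by positivity)
          _ = 10 * B * (η * δ * s) := by ring
          _ ≤ 60 * (η * δ * s) :=
              mul_le_mul_of_nonneg_right (by linarith) (mul_nonneg hx hs0)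
          _ = _ := by ring
      have hD' : D + δ * (G - 2 * D) - 60 * η * δ * s ≤ y1 (k + 1) - 1 + (k + 1) * δ := by
        have := h1 k
        have e : ((k : ℝ) + 1) * δ = s + δ := by rw [hs]; ring
        rw [e, hGdef]
        linarith
      have hηs : 60 * η * δ * s ≤ c / 2 * (δ * s) := by
        have : 60 * η ≤ c / 2 := by rw [hc]; linarith
        calc 60 * η * δ * s = 60 * η * (δ * s) := by ring
          _ ≤ _ := mul_le_mul_of_nonneg_right this (mul_nonneg hδ0 hs0)
      have hηs1 : 60 * η * δ * s ≤ 60 * η * δ := by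
        have : 0 ≤ 60 * η * δ := by positivity
        nlinarith
      have hGδ := mul_le_mul_of_nonneg_left hG hδ0
      refine ⟨?_, ?_⟩
      · refine le_trans ?_ hD'
        have e1 : c / 8 * (((k : ℝ) + 1) * ((k : ℝ) + 1 - 1) * δ ^ 2) =
            c / 8 * ((k : ℝ) * ((k : ℝ) - 1) * δ ^ 2) + c / 4 * (δ * s) := by rw [hs]; ring
        have e2 : c / 8 * ((k : ℝ) * ((k : ℝ) - 1) * δ ^ 2) * (1 - 2 * δ) ≤ D * (1 - 2 * δ) :=
          mul_le_mul_of_nonneg_right hD (by linarith)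
        have e3 : 2 * δ * (c / 8 * ((k : ℝ) * ((k : ℝ) - 1) * δ ^ 2)) ≤ c / 4 * (δ * s) := by
          have : (k : ℝ) * ((k : ℝ) - 1) * δ ^ 2 ≤ s := by
            have h3 : (k : ℝ) * ((k : ℝ) - 1) * δ ^ 2 = s * s - s * δ := by rw [hs]; ring
            rw [h3]; nlinarith
          calc _ = c / 4 * δ * ((k : ℝ) * ((k : ℝ) - 1) * δ ^ 2) := by ring
            _ ≤ c / 4 * δ * s := mul_le_mul_of_nonneg_left this (by positivity)
            _ = _ := by ring
        rw [e1]
        linarith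
      · have h2k := h2 k
        have hstep : G + δ * ((6 - B) - (10 - B) * G + (14 - 2 * B) * D + 6 * s)
            - 21600 * η * δ - 120 * η * δ ≤
            1 - y2 (k + 1) + 2 * (y1 (k + 1) - 1 + (k + 1) * δ) := by
          have ey2 : y2 k = 1 - G + 2 * D := by rw [hGdef]; ring
          have ey1 : y1 k = 1 - s + D := by rw [hDdef]; ring
          rw [ey2, ey1] at h2k
          linarith
        refine le_trans ?_ hstep
        have f1 : 0 ≤ δ * ((14 - 2 * B) * D + 6 * s) :=
          mul_nonneg hδ0 (add_nonneg (mul_nonneg (by linarith) hD0) (by linarith))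
        have f2 : c * s * (1 - (10 - B) * δ) ≤ G * (1 - (10 - B) * δ) :=
          mul_le_mul_of_nonneg_right hG (by nlinarith)
        have f3 : (10 - B) * δ * (c * s) ≤ 6 * c * δ := by
          calc (10 - B) * δ * (c * s) = (10 - B) * (s * (c * δ)) := by ring
            _ ≤ 6 * (1 * (c * δ)) := by
                apply mul_le_mul (by linarith) _ (by positivity) (by norm_num)
                exact mul_le_mul_of_nonneg_right hkδ (by positivity)
            _ = _ := by ring
        have f4 : 22000 * η * δ ≤ 7 * c * δ := by
          apply mul_le_mul_of_nonneg_right _ hδ0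
          rw [hc]; linarith
        have f5 : δ * (6 - B) = 14 * c * δ := by rw [hc]; ring
        have f6 : 0 ≤ η * δ := mul_nonneg hη0 hδ0
        have e : ((k : ℝ) + 1) * δ = s + δ := by rw [hs]; ring
        rw [e]
        linarith
  have := (main N hN).1
  rw [hc] at this
  linarith

section
variable {Ω : Type*} [Fintype Ω] {a η : ℝ} {Q t : Ω → ℝ}

/-- After `N` observations, each of normalised strength `δ = a (1 - a) E t²`, the normalised
squared deviation of the posterior is at most `N δ - c (N δ)²`. -/
lemma postExp_sq_dev_le (ha0 : 0 < a) (ha1 : a < 1) (hQ : ∀ ω, 0 ≤ Q ω)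
    (hQ1 : ∑ ω, Q ω = 1) (hQt : ∑ ω, Q ω * t ω = 0) (ht : ∀ ω, |t ω| ≤ η) (hη : η ≤ 1 / 2)
    {N : ℕ} (hN2 : 2 ≤ N) {δ B : ℝ} (hB : B * (a * (1 - a)) = 1) (hB6 : B ≤ 6)
    (hηB : 44000 * η ≤ 6 - B) (hδ : a * (1 - a) * (∑ ω, Q ω * t ω ^ 2) = δ)
    (hδ6 : δ ≤ 1 / 6) (hNδ : (N : ℝ) * δ ≤ 1) :
    B * postExp a Q t N (fun p => (p - a) ^ 2) ≤ N * δ - (6 - B) / 224 * (N * δ) ^ 2 := by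
  have ht' : ∀ ω, |t ω| ≤ 1 / 2 := fun ω => (ht ω).trans hη
  set g := a * (1 - a) with hg
  set τ := ∑ ω, Q ω * t ω ^ 2 with hτ
  have hg0 : 0 < g := mul_pos ha0 (by linarith)
  have hg4 : g ≤ 1 / 4 := by rw [hg]; nlinarith [sq_nonneg (2 * a - 1)]
  have hBpos : 0 < B := by
    by_contra! h
    nlinarith
  have hB4 : 4 ≤ B := by nlinarith
  have hτ0 : 0 ≤ τ := Finset.sum_nonneg fun ω _ => mul_nonneg (hQ ω) (sq_nonneg _)
  have hδ0 : 0 ≤ δ := hδ ▸ mul_nonneg hg0.le hτ0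
  have hτB : τ = B * δ := by rw [← hδ, ← mul_assoc, hB, one_mul]
  have hη0 : 0 ≤ η := by
    rcases isEmpty_or_nonempty Ω with h | ⟨⟨ω⟩⟩
    · simp at hQ1
    · exact (abs_nonneg _).trans (ht ω)
  have key := moment_comparison (B := B) (δ := δ) (η := η)
    (y1 := fun k => B * postExp a Q t k (fun p => p * (1 - p)))
    (y2 := fun k => B ^ 2 * postExp a Q t k (fun p => (p * (1 - p)) ^ 2)) (N := N)
    hB4 hB6 hδ0 hδ6 hη0 hηB hNδ
    (by simp only [postExp_zero]; exact hB)
    (by simp only [postExp_zero]; rw [← mul_pow, hB, one_pow])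
    (fun k => by
      have h := mul_le_mul_of_nonneg_left
        (postExp_variance_succ_lower ha0 ha1 hQ hQ1 hQt ht hη k) hBpos.le
      rw [← hτ, hτB, ← hg] at h
      refine le_trans (le_of_eq ?_) h
      linear_combination (2 * η * B * δ) * hB)
    (fun k => by
      have h := mul_le_mul_of_nonneg_left
        (postExp_variance_succ_lower_crude ha0 ha1 hQ hQ1 hQt ht' k) hBpos.le
      rw [← hτ, hτB] at h
      refine le_trans ?_ h
      have hBB : B ^ 2 * δ ≤ 36 * δ := mul_le_mul_of_nonneg_right (by nlinarith) hδ0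
      linarith)
    (fun k => by
      have h := mul_le_mul_of_nonneg_left
        (postExp_variance_sq_succ_upper ha0 ha1 hQ hQ1 hQt ht hη k) (sq_nonneg B)
      have h3 := mul_le_mul_of_nonneg_left
        (postExp_variance_cube_lower ha0 ha1 hQ ht' k g)
        (by positivity : 0 ≤ B ^ 3 * (6 * δ))
      rw [← hτ, hτB] at h
      refine h.trans ?_
      have hBBB : B ^ 3 * (100 * η * δ) ≤ 216 * (100 * η * δ) := by
        refine mul_le_mul_of_nonneg_right ?_ (by positivity)
        calc B ^ 3 ≤ 6 ^ 3 := pow_le_pow_left₀ hBpos.le hB6 3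
          _ = 216 := by norm_num
      generalize postExp a Q t k (fun p => (p * (1 - p)) ^ 3) = X3 at *
      generalize postExp a Q t k (fun p => (p * (1 - p)) ^ 2) = X2 at *
      generalize postExp a Q t k (fun p => p * (1 - p)) = X1 at *
      have e : B ^ 3 * (6 * δ) * (2 * g * X2 - g ^ 2 * X1) =
          12 * δ * B ^ 2 * X2 - 6 * δ * B * X1 := by
        linear_combination (12 * δ * B ^ 2 * X2 - 6 * δ * B * X1 * (B * g + 1)) * hB
      rw [e] at h3
      linarith)
  rw [postExp_sq_dev ha0 ha1 hQ hQ1 hQt ht']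
  have hN : (2 : ℝ) ≤ N := by exact_mod_cast hN2
  have h1 : (N : ℝ) * N / 2 * δ ^ 2 ≤ N * ((N : ℝ) - 1) * δ ^ 2 :=
    mul_le_mul_of_nonneg_right (by nlinarith) (sq_nonneg δ)
  have h2 := mul_le_mul_of_nonneg_left h1 (by linarith : 0 ≤ (6 - B) / 112)
  have h3 : B * (g - postExp a Q t N (fun p => p * (1 - p))) =
      1 - B * postExp a Q t N (fun p => p * (1 - p)) := by rw [mul_sub, hB]
  rw [h3]
  linarith

/-- Summing over all `k`-tuples of observations computes the iterated update operator. -/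
lemma sum_prod_likelihood (ha0 : 0 < a) (ha1 : a < 1) (hQ : ∀ ω, 0 ≤ Q ω)
    (ht : ∀ ω, |t ω| ≤ 1 / 2) (f : ℝ → ℝ) (k : ℕ) : ∀ P0 P1 : ℝ, 0 ≤ P0 → 0 ≤ P1 →
    ∑ A : Fin k → Ω,
        (P0 * (∏ j, (Q (A j) * (1 + t (A j) * (1 - a)))) +
          P1 * (∏ j, (Q (A j) * (1 - t (A j) * a)))) *
        f (P0 * (∏ j, (Q (A j) * (1 + t (A j) * (1 - a)))) /
          (P0 * (∏ j, (Q (A j) * (1 + t (A j) * (1 - a)))) +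
          P1 * (∏ j, (Q (A j) * (1 - t (A j) * a))))) =
      (P0 + P1) * (stepOp a Q t ^ k) f (P0 / (P0 + P1)) := by
  induction k with
  | zero => intro P0 P1 _ _; simp
  | succ k ih =>
    intro P0 P1 h0 h1
    rw [pow_succ', Module.End.mul_apply, stepOp_apply, Finset.mul_sum,
      ← (Fin.consEquiv fun _ : Fin (k + 1) => Ω).sum_comp, Fintype.sum_prod_type]
    refine Finset.sum_congr rfl fun ω _ => ?_
    have hpos0 : 0 ≤ 1 + t ω * (1 - a) := by
      have := half_le_one_add_mul (ht ω) (abs_le.2 ⟨by linarith, by linarith⟩ : |1 - a| ≤ 1)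
      linarith
    have hpos1 : 0 ≤ 1 - t ω * a := by
      have := half_le_one_add_mul (ht ω) (abs_le.2 ⟨by linarith, by linarith⟩ : |-a| ≤ 1)
      linarith
    have hN0 : 0 ≤ Q ω * (1 + t ω * (1 - a)) := mul_nonneg (hQ ω) hpos0
    have hN1 : 0 ≤ Q ω * (1 - t ω * a) := mul_nonneg (hQ ω) hpos1
    have hih := ih (P0 * (Q ω * (1 + t ω * (1 - a)))) (P1 * (Q ω * (1 - t ω * a)))
      (mul_nonneg h0 hN0) (mul_nonneg h1 hN1)
    simp only [Fin.consEquiv_apply, Fin.prod_univ_succ, Fin.cons_zero, Fin.cons_succ, ← mul_assoc]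
      at hih ⊢
    rw [hih]
    rcases (add_nonneg h0 h1).eq_or_lt with hP | hP
    · have e0 : P0 = 0 := by linarith
      have e1 : P1 = 0 := by linarith
      simp [e0, e1]
    rcases (hQ ω).eq_or_lt with hq | hq
    · simp [← hq]
    have hm := half_le_one_add_mul (ht ω) (abs_sub_le_one_of_mem ha0 ha1
      (div_nonneg h0 hP.le) ((div_le_one hP).2 (by linarith) : P0 / (P0 + P1) ≤ 1))
    have hsum : P0 * Q ω * (1 + t ω * (1 - a)) + P1 * Q ω * (1 - t ω * a) =
        (P0 + P1) * Q ω * (1 + t ω * (P0 / (P0 + P1) - a)) := by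
      field_simp
      ring
    rw [hsum]
    congr 2
    have hm' : 1 + t ω * (P0 / (P0 + P1) - a) ≠ 0 := by linarith
    refine congrArg _ ?_
    rw [div_eq_div_iff (mul_ne_zero (mul_ne_zero hP.ne' hq.ne') hm') hm']
    field_simp
end

/-- The law of the level-`n` spins given the root spin, computed by recursion over the subtrees
of the children of the root. -/
noncomputable def levelLaw (d : ℕ) (M : Fin 2 → Fin 2 → ℝ) : ∀ n : ℕ, Fin 2 → LConf d n → ℝ
  | 0, i, A => if A (fun k => k.elim0) = i then 1 else 0
  | n + 1, i, A => ∏ j : Fin d, ∑ k : Fin 2, M i k * levelLaw d M n k (restrictChild j A)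

lemma conf_zero_ext {d : ℕ} (A B : LConf d 0)
    (h : A (fun k => k.elim0) = B (fun k => k.elim0)) : A = B := by
  funext v
  rw [Subsingleton.elim v (fun k => k.elim0), h]

/-- Level-`(n+1)` configurations are families of level-`n` configurations of the subtrees. -/
def childEquiv (d n : ℕ) : LConf d (n + 1) ≃ (Fin d → LConf d n) where
  toFun A := fun j => restrictChild j A
  invFun F := fun v => F (v 0) (Fin.tail v)
  left_inv A := by
    funext v
    simp [restrictChild, Fin.cons_self_tail]
  right_inv F := by
    funext j w
    simp [restrictChild]

lemma levelLaw_succ_eq_sum (d : ℕ) (M : Fin 2 → Fin 2 → ℝ) (n : ℕ) : ∀ (i : Fin 2)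
    (A : LConf d (n + 1)), levelLaw d M (n + 1) i A =
      ∑ B : LConf d n, levelLaw d M n i B *
        ∏ v : Vert d (n + 1), M (B (v ∘ Fin.castSucc)) (A v) := by
  induction n with
  | zero =>
    intro i A
    rw [Finset.sum_eq_single (fun _ => i)]
    · simp only [levelLaw, restrictChild]
      rw [if_pos trivial, one_mul, ← (Equiv.funUnique (Fin 1) (Fin d)).symm.prod_comp]
      refine Finset.prod_congr rfl fun j _ => ?_
      have hsum : ∀ x : Fin 2, ∑ k : Fin 2, M i k * (if x = k then 1 else 0) = M i x := by
        intro x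
        simp
      refine (hsum _).trans ?_
      congr 2
      funext l
      obtain rfl : l = 0 := Fin.fin_one_eq_zero l
      rfl
    · intro B _ hB
      rw [levelLaw, if_neg, zero_mul]
      exact fun h => hB (conf_zero_ext _ _ h)
    · intro h
      exact absurd (Finset.mem_univ _) h
  | succ n ih =>
    intro i A
    rw [← (childEquiv d n).symm.sum_comp]
    have hv : ∀ F : Fin d → LConf d n,
        ∏ v : Vert d (n + 2), M ((childEquiv d n).symm F (v ∘ Fin.castSucc)) (A v) =
        ∏ j : Fin d, ∏ w : Vert d (n + 1), M (F j (w ∘ Fin.castSucc)) (restrictChild j A w) := by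
      intro F
      rw [← (Fin.consEquiv fun _ : Fin (n + 2) => Fin d).prod_comp, Fintype.prod_prod_type]
      refine Finset.prod_congr rfl fun j _ => Finset.prod_congr rfl fun w _ => ?_
      rfl
    calc levelLaw d M (n + 2) i A
        = ∏ j : Fin d, ∑ k : Fin 2, M i k * ∑ B : LConf d n, levelLaw d M n k B *
            ∏ w : Vert d (n + 1), M (B (w ∘ Fin.castSucc)) (restrictChild j A w) := by
          rw [levelLaw]
          simp only [ih]
      _ = ∏ j : Fin d, ∑ B : LConf d n, (∑ k : Fin 2, M i k * levelLaw d M n k B) *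
            ∏ w : Vert d (n + 1), M (B (w ∘ Fin.castSucc)) (restrictChild j A w) := by
          refine Finset.prod_congr rfl fun j _ => ?_
          simp only [Finset.mul_sum, Finset.sum_mul]
          rw [Finset.sum_comm]
          simp only [mul_assoc]
      _ = _ := by
          rw [Fintype.prod_sum]
          refine Finset.sum_congr rfl fun F _ => ?_
          rw [Finset.prod_mul_distrib, hv, levelLaw]
          have : ∀ j, restrictChild j ((childEquiv d n).symm F) = F j := fun j =>
            congrFun ((childEquiv d n).apply_symm_apply F) j
          simp only [this]

lemma confProb_snoc (d : ℕ) (θ Δ : ℝ) (n : ℕ) (σ : Conf d n) (C : LConf d (n + 1)) :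
    confProb d θ Δ (n + 1) (Fin.snoc (α := fun k : Fin (n + 2) => Vert d k → Fin 2) σ C) =
      confProb d θ Δ n σ * ∏ v : Vert d (n + 1), Mmat θ Δ (top σ (v ∘ Fin.castSucc)) (C v) := by
  unfold confProb
  rw [Fin.prod_univ_castSucc, mul_assoc]
  congr 1
  congr 1
  · refine Finset.prod_congr rfl fun k _ => Finset.prod_congr rfl fun v _ => ?_
    have h1 := Fin.snoc_castSucc (α := fun k : Fin (n + 2) => Vert d k → Fin 2) C σ k.castSucc
    have h2 := Fin.snoc_castSucc (α := fun k : Fin (n + 2) => Vert d k → Fin 2) C σ k.succ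
    exact congrArg₂ (Mmat θ Δ) (congrFun h1 _) (congrFun h2 _)
  · refine Finset.prod_congr rfl fun v _ => ?_
    have h1 := Fin.snoc_castSucc (α := fun k : Fin (n + 2) => Vert d k → Fin 2) C σ (Fin.last n)
    have h2 := Fin.snoc_last (α := fun k : Fin (n + 2) => Vert d k → Fin 2) C σ
    exact congrArg₂ (Mmat θ Δ) (congrFun h1 _) (congrFun h2 _)

/-- The joint law of root and level `n + 1` is obtained by propagating level `n` one step. -/
lemma jointProb_succ (d : ℕ) (θ Δ : ℝ) (n : ℕ) (i : Fin 2) (A : LConf d (n + 1)) :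
    jointProb d θ Δ (n + 1) i A = ∑ B : LConf d n, jointProb d θ Δ n i B *
      ∏ v : Vert d (n + 1), Mmat θ Δ (B (v ∘ Fin.castSucc)) (A v) := by
  calc jointProb d θ Δ (n + 1) i A
      = ∑ C : LConf d (n + 1), ∑ σ : Conf d n, if root σ = i ∧ C = A then
          confProb d θ Δ n σ * ∏ v : Vert d (n + 1), Mmat θ Δ (top σ (v ∘ Fin.castSucc)) (C v)
          else 0 := by
        unfold jointProb
        rw [← (Fin.snocEquiv fun k : Fin (n + 2) => Vert d k → Fin 2).sum_comp,
          Fintype.sum_prod_type]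
        refine Finset.sum_congr rfl fun C _ => Finset.sum_congr rfl fun σ _ => ?_
        have h1 : root (d := d) (n := n + 1)
            (Fin.snoc (α := fun k : Fin (n + 2) => Vert d k → Fin 2) σ C) = root σ :=
          congrFun (Fin.snoc_castSucc (α := fun k : Fin (n + 2) => Vert d k → Fin 2) C σ 0) _
        have h2 : top (d := d) (n := n + 1)
            (Fin.snoc (α := fun k : Fin (n + 2) => Vert d k → Fin 2) σ C) = C :=
          Fin.snoc_last (α := fun k : Fin (n + 2) => Vert d k → Fin 2) C σ
        have h3 := confProb_snoc d θ Δ n σ C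
        rw [← h3]
        refine if_congr ?_ rfl rfl
        change root (d := d) (n := n + 1)
            (Fin.snoc (α := fun k : Fin (n + 2) => Vert d k → Fin 2) σ C) = i ∧
          top (d := d) (n := n + 1)
            (Fin.snoc (α := fun k : Fin (n + 2) => Vert d k → Fin 2) σ C) = A ↔ _
        rw [h1, h2]
    _ = ∑ σ : Conf d n, if root σ = i then
          confProb d θ Δ n σ * ∏ v : Vert d (n + 1), Mmat θ Δ (top σ (v ∘ Fin.castSucc)) (A v)
          else 0 := by
        rw [Finset.sum_comm]
        refine Finset.sum_congr rfl fun σ _ => ?_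
        rw [Finset.sum_eq_single A]
        · simp
        · intro C _ hC
          rw [if_neg fun h => hC h.2]
        · intro h
          exact absurd (Finset.mem_univ _) h
    _ = _ := by
        unfold jointProb
        simp only [Finset.sum_mul]
        rw [Finset.sum_comm]
        refine Finset.sum_congr rfl fun σ _ => ?_
        rw [Finset.sum_eq_single (top σ)]
        · simp [ite_mul]
        · intro C _ hC
          rw [if_neg fun h => hC h.2.symm, zero_mul]
        · intro h
          exact absurd (Finset.mem_univ _) h

lemma jointProb_eq (d : ℕ) (θ Δ : ℝ) (n : ℕ) : ∀ (i : Fin 2) (A : LConf d n),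
    jointProb d θ Δ n i A = pst θ Δ i * levelLaw d (Mmat θ Δ) n i A := by
  induction n with
  | zero =>
    intro i A
    rw [jointProb, Finset.sum_eq_single (fun k _ => A (fun l => l.elim0))]
    · have htop : top (d := d) (n := 0) (fun k _ => A (fun l => l.elim0)) = A :=
        conf_zero_ext _ _ rfl
      have hroot : root (d := d) (n := 0) (fun k _ => A (fun l => l.elim0)) =
        A (fun l => l.elim0) := rfl
      rw [htop, hroot, levelLaw, confProb, hroot]
      by_cases h : A (fun l => l.elim0) = i
      · simp [h]
      · simp [h]
    · intro σ _ hσ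
      rw [if_neg]
      rintro ⟨-, h⟩
      refine hσ (funext fun k => ?_)
      obtain rfl : k = Fin.last 0 := Fin.fin_one_eq_zero k
      have h' : σ (Fin.last 0) = A := h
      rw [h']
      exact conf_zero_ext _ _ rfl
    · intro h
      exact absurd (Finset.mem_univ _) h
  | succ n ih =>
    intro i A
    rw [jointProb_succ, levelLaw_succ_eq_sum, Finset.mul_sum]
    simp only [ih, mul_assoc]

lemma levelLaw_nonneg {d : ℕ} {M : Fin 2 → Fin 2 → ℝ} (hM : ∀ i j, 0 ≤ M i j) :
    ∀ (n : ℕ) (i : Fin 2) (A : LConf d n), 0 ≤ levelLaw d M n i A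
  | 0, i, A => by rw [levelLaw]; split_ifs <;> norm_num
  | n + 1, i, A => by
    rw [levelLaw]
    exact Finset.prod_nonneg fun j _ => Finset.sum_nonneg fun k _ =>
      mul_nonneg (hM i k) (levelLaw_nonneg hM n k _)

lemma sum_levelLaw_succ {d : ℕ} {M : Fin 2 → Fin 2 → ℝ} (n : ℕ) (i : Fin 2) :
    ∑ A : LConf d (n + 1), levelLaw d M (n + 1) i A =
      ∏ _j : Fin d, ∑ B : LConf d n, ∑ k : Fin 2, M i k * levelLaw d M n k B := by
  rw [Fintype.prod_sum, ← (childEquiv d n).sum_comp]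
  rfl

lemma sum_levelLaw {d : ℕ} {M : Fin 2 → Fin 2 → ℝ} (hM : ∀ i, ∑ j, M i j = 1) (n : ℕ) :
    ∀ i : Fin 2, ∑ A : LConf d n, levelLaw d M n i A = 1 := by
  induction n with
  | zero =>
    intro i
    rw [Finset.sum_eq_single (fun _ => i)]
    · simp [levelLaw]
    · intro B _ hB
      rw [levelLaw, if_neg]
      exact fun h => hB (conf_zero_ext _ _ h)
    · intro h
      exact absurd (Finset.mem_univ _) h
  | succ n ih =>
    intro i
    rw [sum_levelLaw_succ]
    refine Finset.prod_eq_one fun j _ => ?_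
    rw [Finset.sum_comm]
    simp only [← Finset.mul_sum, ih, mul_one, hM]

/-- The channel with second eigenvalue `θ` and stationary distribution `(a, 1 - a)`. -/
lemma Mmat_Dlt (θ a : ℝ) :
    Mmat θ (Dlt θ a (1 - a)) 0 0 = θ + (1 - θ) * a ∧
    Mmat θ (Dlt θ a (1 - a)) 0 1 = (1 - θ) * (1 - a) ∧
    Mmat θ (Dlt θ a (1 - a)) 1 0 = (1 - θ) * a ∧
    Mmat θ (Dlt θ a (1 - a)) 1 1 = θ + (1 - θ) * (1 - a) := by
  refine ⟨?_, ?_, ?_, ?_⟩ <;> simp [Mmat, Dlt] <;> ring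

lemma Mmat_Dlt_nonneg {θ a : ℝ} (ha0 : 0 < a) (ha1 : a < 1) (hθ : |θ| ≤ a * (1 - a))
    (i j : Fin 2) : 0 ≤ Mmat θ (Dlt θ a (1 - a)) i j := by
  obtain ⟨h00, h01, h10, h11⟩ := Mmat_Dlt θ a
  obtain ⟨hl, hu⟩ := abs_le.1 hθ
  have hb : 0 < 1 - a := by linarith
  have h1 : 0 ≤ 1 - θ := by nlinarith
  fin_cases i <;> fin_cases j
  · change 0 ≤ Mmat θ (Dlt θ a (1 - a)) 0 0
    rw [h00]; nlinarith [mul_pos ha0 hb]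
  · change 0 ≤ Mmat θ (Dlt θ a (1 - a)) 0 1
    rw [h01]; positivity
  · change 0 ≤ Mmat θ (Dlt θ a (1 - a)) 1 0
    rw [h10]; positivity
  · change 0 ≤ Mmat θ (Dlt θ a (1 - a)) 1 1
    rw [h11]; nlinarith [mul_pos ha0 hb]

lemma sum_Mmat (θ Δ : ℝ) (i : Fin 2) : ∑ j, Mmat θ Δ i j = 1 := by
  fin_cases i <;> simp [Mmat, Fin.sum_univ_two] <;> ring

lemma pst_Dlt {θ a : ℝ} (hθ : θ < 1) :
    pst θ (Dlt θ a (1 - a)) 0 = a ∧ pst θ (Dlt θ a (1 - a)) 1 = 1 - a := by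
  have : 1 - θ ≠ 0 := by linarith
  constructor
  · simp only [pst, Dlt, if_true]
    field_simp
    ring
  · simp only [pst, Dlt, one_ne_zero, if_false]
    field_simp
    ring

lemma condLevel_eq_levelLaw {d n : ℕ} {θ Δ : ℝ} {i : Fin 2} (h : pst θ Δ i ≠ 0)
    (A : LConf d n) : condLevel d θ Δ n i A = levelLaw d (Mmat θ Δ) n i A := by
  rw [condLevel, jointProb_eq, mul_div_cancel_left₀ _ h]

/-- The stationary law of the level-`n` spins. -/
noncomputable def mixLaw (a : ℝ) (d : ℕ) (M : Fin 2 → Fin 2 → ℝ) (n : ℕ) (A : LConf d n) : ℝ :=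
  a * levelLaw d M n 0 A + (1 - a) * levelLaw d M n 1 A

/-- The posterior probability of the first state at the root given the level-`n` spins. -/
noncomputable def rootPost (a : ℝ) (d : ℕ) (M : Fin 2 → Fin 2 → ℝ) (n : ℕ) (A : LConf d n) : ℝ :=
  a * levelLaw d M n 0 A / mixLaw a d M n A

/-- The variance of the root posterior under the stationary law. -/
noncomputable def postVar (a : ℝ) (d : ℕ) (M : Fin 2 → Fin 2 → ℝ) (n : ℕ) : ℝ :=
  ∑ A : LConf d n, mixLaw a d M n A * (rootPost a d M n A - a) ^ 2

section MixLaw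

variable {a : ℝ} {d : ℕ} {M : Fin 2 → Fin 2 → ℝ} (ha0 : 0 < a) (ha1 : a < 1)
  (hM : ∀ i j, 0 ≤ M i j) (hM1 : ∀ i, ∑ j, M i j = 1) (n : ℕ)

include ha0 ha1 hM in
lemma mixLaw_nonneg (A : LConf d n) : 0 ≤ mixLaw a d M n A :=
  add_nonneg (mul_nonneg ha0.le (levelLaw_nonneg hM n 0 A))
    (mul_nonneg (by linarith) (levelLaw_nonneg hM n 1 A))

include hM1 in
lemma sum_mixLaw : ∑ A : LConf d n, mixLaw a d M n A = 1 := by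
  simp only [mixLaw, Finset.sum_add_distrib, ← Finset.mul_sum, sum_levelLaw hM1]
  ring

include ha0 ha1 hM in
lemma mixLaw_mul_rootPost (A : LConf d n) :
    mixLaw a d M n A * rootPost a d M n A = a * levelLaw d M n 0 A := by
  rcases eq_or_ne (mixLaw a d M n A) 0 with h | h
  · have h0 := mul_nonneg ha0.le (levelLaw_nonneg hM n 0 A)
    have h1 := mul_nonneg (by linarith : 0 ≤ 1 - a) (levelLaw_nonneg hM n 1 A)
    rw [h, zero_mul]
    rw [mixLaw] at h
    linarith
  · rw [rootPost, mul_div_cancel₀ _ h]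

include ha0 ha1 hM in
lemma rootPost_mem (A : LConf d n) : 0 ≤ rootPost a d M n A ∧ rootPost a d M n A ≤ 1 := by
  have h0 := mul_nonneg ha0.le (levelLaw_nonneg hM n 0 A)
  have h1 := mul_nonneg (by linarith : 0 ≤ 1 - a) (levelLaw_nonneg hM n 1 A)
  have h2 := mixLaw_nonneg ha0 ha1 hM n A
  exact ⟨div_nonneg h0 h2, div_le_one_of_le₀ (by rw [mixLaw]; linarith) h2⟩

include ha0 ha1 hM in
lemma mixLaw_mul_dev (A : LConf d n) :
    mixLaw a d M n A * (rootPost a d M n A - a) =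
      a * (1 - a) * (levelLaw d M n 0 A - levelLaw d M n 1 A) := by
  rw [mul_sub, mixLaw_mul_rootPost ha0 ha1 hM, mixLaw]
  ring

include ha0 ha1 hM hM1 in
lemma sum_mixLaw_mul_dev :
    ∑ A : LConf d n, mixLaw a d M n A * (rootPost a d M n A - a) = 0 := by
  simp only [mixLaw_mul_dev ha0 ha1 hM, ← Finset.mul_sum, Finset.sum_sub_distrib,
    sum_levelLaw hM1]
  ring

include ha0 ha1 hM in
lemma postVar_nonneg : 0 ≤ postVar a d M n :=
  Finset.sum_nonneg fun A _ => mul_nonneg (mixLaw_nonneg ha0 ha1 hM n A) (sq_nonneg _)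

include ha0 ha1 hM hM1 in
lemma postVar_le : postVar a d M n ≤ a * (1 - a) := by
  calc postVar a d M n
      ≤ ∑ A : LConf d n, ((1 - 2 * a) * (mixLaw a d M n A * (rootPost a d M n A - a)) +
          a * (1 - a) * mixLaw a d M n A) := by
        refine Finset.sum_le_sum fun A _ => ?_
        obtain ⟨h0, h1⟩ := rootPost_mem ha0 ha1 hM n A
        have := mul_nonneg (mixLaw_nonneg ha0 ha1 hM n A) (mul_nonneg h0 (sub_nonneg.2 h1))
        linarith
    _ = a * (1 - a) := by
        rw [Finset.sum_add_distrib, ← Finset.mul_sum, ← Finset.mul_sum,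
          sum_mixLaw_mul_dev ha0 ha1 hM hM1, sum_mixLaw hM1]
        ring

include ha0 ha1 hM hM1 in
/-- The total variation distance is controlled by the variance of the root posterior. -/
lemma sq_sum_abs_sub_le :
    (a * (1 - a) * ∑ A : LConf d n, |levelLaw d M n 0 A - levelLaw d M n 1 A|) ^ 2 ≤
      postVar a d M n := by
  have hg : 0 ≤ a * (1 - a) := mul_nonneg ha0.le (by linarith)
  have h1 : a * (1 - a) * ∑ A : LConf d n, |levelLaw d M n 0 A - levelLaw d M n 1 A| =
      ∑ A : LConf d n, mixLaw a d M n A * |rootPost a d M n A - a| := by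
    rw [Finset.mul_sum]
    refine Finset.sum_congr rfl fun A _ => ?_
    calc a * (1 - a) * |levelLaw d M n 0 A - levelLaw d M n 1 A|
        = |a * (1 - a) * (levelLaw d M n 0 A - levelLaw d M n 1 A)| := by
          rw [abs_mul, abs_of_nonneg hg]
      _ = |mixLaw a d M n A * (rootPost a d M n A - a)| := by rw [mixLaw_mul_dev ha0 ha1 hM]
      _ = mixLaw a d M n A * |rootPost a d M n A - a| := by
          rw [abs_mul, abs_of_nonneg (mixLaw_nonneg ha0 ha1 hM n A)]
  rw [h1]
  have h2 := Finset.sum_sq_le_sum_mul_sum_of_sq_le_mul (Finset.univ : Finset (LConf d n))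
    (r := fun A => mixLaw a d M n A * |rootPost a d M n A - a|)
    (f := fun A => mixLaw a d M n A)
    (g := fun A => mixLaw a d M n A * (rootPost a d M n A - a) ^ 2)
    (fun A _ => mixLaw_nonneg ha0 ha1 hM n A)
    (fun A _ => mul_nonneg (mixLaw_nonneg ha0 ha1 hM n A) (sq_nonneg _))
    (fun A _ => le_of_eq (by rw [mul_pow, sq_abs]; ring))
  rwa [sum_mixLaw hM1, one_mul] at h2

end MixLaw

/-- The variance of the root posterior at level `n + 1` as an expectation over `d` independent
observations of level-`n` subtrees. -/
lemma postVar_succ {a θ B : ℝ} (d n : ℕ) (ha0 : 0 < a) (ha1 : a < 1)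
    (hB : B * (a * (1 - a)) = 1) (hθ : |θ| ≤ a * (1 - a))
    (ht : ∀ A : LConf d n,
      |θ * B * (rootPost a d (Mmat θ (Dlt θ a (1 - a))) n A - a)| ≤ 1 / 2) :
    postVar a d (Mmat θ (Dlt θ a (1 - a))) (n + 1) =
      postExp a (mixLaw a d (Mmat θ (Dlt θ a (1 - a))) n)
        (fun A => θ * B * (rootPost a d (Mmat θ (Dlt θ a (1 - a))) n A - a)) d
        (fun p => (p - a) ^ 2) := by
  have hM := Mmat_Dlt_nonneg ha0 ha1 hθ
  obtain ⟨h00, h01, h10, h11⟩ := Mmat_Dlt θ a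
  set M := Mmat θ (Dlt θ a (1 - a))
  have hsum := sum_prod_likelihood ha0 ha1 (mixLaw_nonneg ha0 ha1 hM n) ht
    (fun p => (p - a) ^ 2) d a (1 - a) ha0.le (by linarith)
  rw [add_sub_cancel, div_one, one_mul] at hsum
  rw [postExp, ← hsum, postVar, ← (childEquiv d n).sum_comp]
  have hL0 : ∀ A : LConf d n, ∑ k, M 0 k * levelLaw d M n k A =
      mixLaw a d M n A * (1 + θ * B * (rootPost a d M n A - a) * (1 - a)) := by
    intro A
    have := mixLaw_mul_dev ha0 ha1 hM n A
    rw [Fin.sum_univ_two, h00, h01]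
    have e : mixLaw a d M n A * (1 + θ * B * (rootPost a d M n A - a) * (1 - a)) =
      mixLaw a d M n A + θ * B * (1 - a) *
        (mixLaw a d M n A * (rootPost a d M n A - a)) := by ring
    rw [e, this, mixLaw]
    linear_combination
      -(θ * (1 - a) * (levelLaw d M n 0 A - levelLaw d M n 1 A)) * hB
  have hL1 : ∀ A : LConf d n, ∑ k, M 1 k * levelLaw d M n k A =
      mixLaw a d M n A * (1 - θ * B * (rootPost a d M n A - a) * a) := by
    intro A
    have := mixLaw_mul_dev ha0 ha1 hM n A
    rw [Fin.sum_univ_two, h10, h11]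
    have e : mixLaw a d M n A * (1 - θ * B * (rootPost a d M n A - a) * a) =
      mixLaw a d M n A - θ * B * a *
        (mixLaw a d M n A * (rootPost a d M n A - a)) := by ring
    rw [e, this, mixLaw]
    linear_combination
      (θ * a * (levelLaw d M n 0 A - levelLaw d M n 1 A)) * hB
  refine Finset.sum_congr rfl fun A _ => ?_
  simp only [rootPost, mixLaw, levelLaw] at hL0 hL1 ⊢
  simp only [hL0, hL1]
  rfl

/-- A nonnegative sequence with `u (n + 1) ≤ u n - c u n ^ 2` tends to zero. -/
lemma tendsto_zero_of_le_sub_sq {u : ℕ → ℝ} {c : ℝ} (hc : 0 < c) (h0 : ∀ n, 0 ≤ u n)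
    (h : ∀ n, u (n + 1) ≤ u n - c * u n ^ 2) : Tendsto u atTop (nhds 0) := by
  have hanti : Antitone u := antitone_nat_of_succ_le fun n => by
    have : 0 ≤ c * u n ^ 2 := by positivity
    linarith [h n]
  have hbdd : BddBelow (Set.range u) := ⟨0, by rintro _ ⟨n, rfl⟩; exact h0 n⟩
  have hlim := tendsto_atTop_ciInf hanti hbdd
  set L := ⨅ n, u n
  have hle : L ≤ L - c * L ^ 2 :=
    le_of_tendsto_of_tendsto' (hlim.comp (tendsto_add_atTop_nat 1))
      (hlim.sub ((hlim.pow 2).const_mul c)) h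
  have hL : L ^ 2 = 0 := by
    have : c * L ^ 2 ≤ 0 := by linarith
    nlinarith [sq_nonneg L]
  rwa [pow_eq_zero_iff two_ne_zero |>.1 hL] at hlim

lemma KS_of_small {a θ B : ℝ} {d : ℕ} (ha0 : 0 < a) (ha1 : a < 1)
    (hB : B * (a * (1 - a)) = 1) (hB6 : B < 6) (hd : 6 ≤ d) (hdθ : (d : ℝ) * θ ^ 2 ≤ 1)
    (hθ : 44000 * (|θ| * B) ≤ 6 - B) : nonReconstruction d θ (Dlt θ a (1 - a)) := by
  have hg0 : 0 < a * (1 - a) := mul_pos ha0 (by linarith)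
  have hg4 : a * (1 - a) ≤ 1 / 4 := by nlinarith [sq_nonneg (2 * a - 1)]
  have hBpos : 0 < B := by
    by_contra! h
    nlinarith
  have hB4 : 4 ≤ B := by nlinarith
  have hη : |θ| * B ≤ 1 / 2 := by linarith
  have hθg : |θ| ≤ a * (1 - a) := by
    calc |θ| = |θ| * B * (a * (1 - a)) := by rw [mul_assoc, hB, mul_one]
      _ ≤ 1 * (a * (1 - a)) := mul_le_mul_of_nonneg_right (by linarith) hg0.le
      _ = _ := one_mul _
  have hθ1 : θ < 1 := by linarith [le_abs_self θ]
  obtain ⟨hp0, hp1⟩ := pst_Dlt (a := a) hθ1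
  have hM := Mmat_Dlt_nonneg ha0 ha1 hθg
  have hM1 := sum_Mmat θ (Dlt θ a (1 - a))
  have htv : ∀ n, tvDist d θ (Dlt θ a (1 - a)) n = 1 / 2 * ∑ A : LConf d n,
      |levelLaw d (Mmat θ (Dlt θ a (1 - a))) n 0 A -
        levelLaw d (Mmat θ (Dlt θ a (1 - a))) n 1 A| := by
    intro n
    rw [tvDist]
    congr 1
    refine Finset.sum_congr rfl fun A _ => ?_
    rw [condLevel_eq_levelLaw (by rw [hp0]; exact ha0.ne'),
      condLevel_eq_levelLaw (by rw [hp1]; linarith)]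
  have hrec := postVar_succ (θ := θ) d (ha0 := ha0) (ha1 := ha1) (hB := hB) (hθ := hθg)
  set M := Mmat θ (Dlt θ a (1 - a))
  have hlim : Tendsto (fun n => B * postVar a d M n) atTop (nhds 0) := by
    have hc : 0 < (6 - B) / 224 := by linarith
    refine tendsto_zero_of_le_sub_sq hc
      (fun n => mul_nonneg hBpos.le (postVar_nonneg ha0 ha1 hM n)) fun n => ?_
    have hV0 := mul_nonneg hBpos.le (postVar_nonneg (d := d) ha0 ha1 hM n)
    have hV1 : B * postVar a d M n ≤ 1 := by
      rw [← hB]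
      exact mul_le_mul_of_nonneg_left (postVar_le ha0 ha1 hM hM1 n) hBpos.le
    have ht : ∀ A : LConf d n, |θ * B * (rootPost a d M n A - a)| ≤ |θ| * B := by
      intro A
      obtain ⟨h0, h1⟩ := rootPost_mem ha0 ha1 hM n A
      rw [abs_mul, abs_mul, abs_of_pos hBpos]
      exact mul_le_of_le_one_right (by positivity) (abs_sub_le_one_of_mem ha0 ha1 h0 h1)
    have ht0 : ∑ A : LConf d n, mixLaw a d M n A * (θ * B * (rootPost a d M n A - a)) = 0 := by
      have := congrArg (fun z => θ * B * z) (sum_mixLaw_mul_dev (d := d) ha0 ha1 hM hM1 n)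
      simp only [mul_zero, Finset.mul_sum] at this
      rw [← this]
      exact Finset.sum_congr rfl fun A _ => by ring
    have ht2 : a * (1 - a) *
        ∑ A : LConf d n, mixLaw a d M n A * (θ * B * (rootPost a d M n A - a)) ^ 2 =
        θ ^ 2 * (B * postVar a d M n) := by
      have : ∑ A : LConf d n, mixLaw a d M n A * (θ * B * (rootPost a d M n A - a)) ^ 2 =
          θ ^ 2 * B ^ 2 * postVar a d M n := by
        rw [postVar, Finset.mul_sum]
        exact Finset.sum_congr rfl fun A _ => by ring
      rw [this]
      linear_combination (θ ^ 2 * B * postVar a d M n) * hB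
    have hd' : (6 : ℝ) ≤ d := by exact_mod_cast hd
    rw [hrec n fun A => (ht A).trans hη]
    have hfin := postExp_sq_dev_le ha0 ha1 (mixLaw_nonneg (d := d) ha0 ha1 hM n)
      (sum_mixLaw hM1 n) ht0 ht hη (by omega : 2 ≤ d) hB hB6.le hθ ht2
      (by nlinarith [sq_nonneg θ])
      (by
        rw [← mul_assoc]
        exact mul_le_one₀ hdθ hV0 hV1)
    refine hfin.trans ?_
    set V := B * postVar a d M n
    have hs : (d : ℝ) * (θ ^ 2 * V) ≤ V := by
      rw [← mul_assoc]
      exact mul_le_of_le_one_left hV0 hdθ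
    have hs0 : 0 ≤ (d : ℝ) * (θ ^ 2 * V) := by positivity
    set s := (d : ℝ) * (θ ^ 2 * V)
    have : (6 - B) / 224 * (V + s) ≤ 1 := by
      have : (6 - B) / 224 ≤ 1 / 2 := by linarith
      nlinarith
    nlinarith [mul_nonneg (sub_nonneg.2 hs) (sub_nonneg.2 this)]
  rw [nonReconstruction]
  refine Tendsto.limsup_eq ?_
  have hsqrt : Tendsto (fun n => B / 2 * Real.sqrt (postVar a d M n)) atTop (nhds 0) := by
    have h1 : Tendsto (fun n => B / 2 * Real.sqrt (B⁻¹ * (B * postVar a d M n))) atTop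
        (nhds (B / 2 * Real.sqrt (B⁻¹ * 0))) :=
      ((hlim.const_mul B⁻¹).sqrt).const_mul (B / 2)
    simpa [hBpos.ne'] using h1
  refine squeeze_zero (fun n => ?_) (fun n => ?_) hsqrt
  · rw [htv]
    exact mul_nonneg (by norm_num) (Finset.sum_nonneg fun _ _ => abs_nonneg _)
  · rw [htv]
    have h1 := Real.le_sqrt_of_sq_le (sq_sum_abs_sub_le (d := d) ha0 ha1 hM hM1 n)
    have h2 := mul_le_mul_of_nonneg_left h1 (by linarith : 0 ≤ B / 2)
    refine le_trans (le_of_eq ?_) h2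
    linear_combination (-(1 / 2) * ∑ A : LConf d n,
      |levelLaw d M n 0 A - levelLaw d M n 1 A|) * hB

/-- For every probability vector `π = (π₁, π₂)` with `π₁ ≥ π₂ > 0` and
`6π₁π₂ > 1`, there is a `D = D(π) > 0` such that for every `d > D` and every `θ` with
`dθ² ≤ 1`, taking `Δ = (1−θ)(π₂−π₁)`, there is non-reconstruction on the `d`-ary tree;
in particular at the Kesten–Stigum bound `dθ² = 1`. -/
theorem KS_sharp_large_d (π1 π2 : ℝ) (hsum : π1 + π2 = 1) (hord : π2 ≤ π1)
    (hpi2 : 0 < π2) (h6 : 1 < 6 * π1 * π2) :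
    ∃ D : ℝ, 0 < D ∧ ∀ d : ℕ, D < (d : ℝ) → ∀ θ : ℝ, (d : ℝ) * θ ^ 2 ≤ 1 →
      nonReconstruction d θ (Dlt θ π1 π2) := by
  obtain rfl : π2 = 1 - π1 := by linarith
  have ha0 : 0 < π1 := by linarith
  have hg0 : 0 < π1 * (1 - π1) := mul_pos ha0 hpi2
  have hB : (π1 * (1 - π1))⁻¹ * (π1 * (1 - π1)) = 1 := inv_mul_cancel₀ hg0.ne'
  have hBpos : 0 < (π1 * (1 - π1))⁻¹ := inv_pos.2 hg0
  have hB6 : (π1 * (1 - π1))⁻¹ < 6 := by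
    rw [inv_lt_comm₀ hg0 (by norm_num)]
    linarith
  set B := (π1 * (1 - π1))⁻¹
  have hr : 0 < 6 - B := by linarith
  refine ⟨max 6 ((44000 * B / (6 - B)) ^ 2), by positivity, fun d hd θ hdθ => ?_⟩
  obtain ⟨hd6, hdr⟩ := max_lt_iff.1 hd
  refine KS_of_small ha0 (by linarith) hB hB6 (by exact_mod_cast hd6.le) hdθ ?_
  have h1 : (44000 * B / (6 - B) * |θ|) ^ 2 ≤ 1 := by
    rw [mul_pow, sq_abs]
    exact (mul_le_mul_of_nonneg_right hdr.le (sq_nonneg θ)).trans hdθ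
  have h2 := (sq_le_one_iff₀ (by positivity)).1 h1
  rw [div_mul_eq_mul_div, div_le_one hr] at h2
  linarith

end AsymIsing
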